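/- Let k be a commutative unital ring, R a unital associative (possibly noncommutative) k-algebra, and b, c, e ∈ k with b² = b + ce. Let δ : R → R be a k-linear map satisfying δ(xy) = b(x·δ(y) + δ(x)·y) + c·δ(x)·δ(y) + e·xy for all x, y ∈ R. Then the map α : R → R defined by α(u) = c·δ(u) + b·u is multiplicative: α(uv) = α(u)·α(v) for all u, v ∈ R. -/

import Mathlib

universe u v

/-- For a differential type operator of case (1), the map
`α(u) = c·δ(u) + b·u` is multiplicative. -/
theorem case_one_alpha_multiplicative (k : Type u) [CommRing k]
    (R : Type v) [Ring R] [Algebra k R] (b c e : k) (hb : b ^ 2 = b + c * e)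
    (δ : R →ₗ[k] R)
    (hδ : ∀ x y : R, δ (x * y) = b • (x * δ y + δ x * y) + c • (δ x * δ y) + e • (x * y)) :
    ∀ u v : R, c • δ (u * v) + b • (u * v) = (c • δ u + b • u) * (c • δ v + b • v) := by
  intro u v
  have huv : (b ^ 2) • (u * v) = (b + c * e) • (u * v) := by rw [hb]
  rw [hδ]
  simp only [add_mul, mul_add, smul_mul_assoc, mul_smul_comm, smul_add, smul_smul, add_smul,
    pow_two, mul_comm b c] at huv ⊢
  rw [huv]
  abel
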